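/- Suppose T : X → X is a continuous map of a compact metric space, Y is a compact metric space with continuous map S, and π : X → Y is a continuous surjection with π∘T = S∘π such that for every y ∈ Y the topological entropy of T restricted to π^{-1}(y) is zero. Then for every T-invariant Borel probability measure μ on X, h(T, μ) = h(S, π_*μ). -/

import Mathlib

open MeasureTheory Dynamics

/-- A finite measurable partition of `X`, given as a finset of sets. -/
def IsFinPartition {X : Type*} [MeasurableSpace X] (P : Finset (Set X)) : Prop :=
  (∀ A ∈ P, MeasurableSet A) ∧ ⋃₀ (P : Set (Set X)) = Set.univ ∧
    ∀ A ∈ P, ∀ B ∈ P, A ≠ B → A ∩ B = ∅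

/-- The Shannon information of a finite collection of sets. -/
noncomputable def partInfo {X : Type*} [MeasurableSpace X] (μ : Measure X)
    (P : Finset (Set X)) : ℝ :=
  ∑ A ∈ P, Real.negMulLog (μ A).toReal

open Classical in
/-- The dynamical refinement `P ∨ T⁻¹P ∨ ⋯ ∨ T⁻⁽ⁿ⁻¹⁾P`. -/
noncomputable def joinPart {X : Type*} (T : X → X) (P : Finset (Set X)) (n : ℕ) :
    Finset (Set X) :=
  (Finset.univ : Finset (Fin n → {A // A ∈ P})).image
    fun f => ⋂ i : Fin n, T^[(i : ℕ)] ⁻¹' (f i : Set X)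

/-- The entropy of `T` relative to the partition `P`. -/
noncomputable def entPart {X : Type*} [MeasurableSpace X] (μ : Measure X)
    (T : X → X) (P : Finset (Set X)) : ℝ :=
  ⨅ n : ℕ, partInfo μ (joinPart T P (n + 1)) / (n + 1)

/-- The Kolmogorov–Sinai entropy `h(T, μ)`: the supremum over all finite
measurable partitions of the entropy relative to the partition. -/
noncomputable def ksEntropy {X : Type*} [MeasurableSpace X] (T : X → X)
    (μ : Measure X) : ℝ :=
  ⨆ P : {P : Finset (Set X) // IsFinPartition P}, entPart μ T (P : Finset (Set X))


/-- Shannon entropy of a finite-valued map. -/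
noncomputable def Hf {X ι : Type*} [MeasurableSpace X] [Fintype ι] (μ : Measure X) (f : X → ι) : ℝ :=
  ∑ i, Real.negMulLog (μ.real (f ⁻¹' {i}))

/-- Itinerary of length `n`. -/
def nm {X ι : Type*} (T : X → X) (p : X → ι) (n : ℕ) (x : X) : Fin n → ι :=
  fun i => p (T^[(i : ℕ)] x)

lemma gibbs {α : Type*} [Fintype α] (p q : α → ℝ) (hp : ∀ a, 0 ≤ p a) (hq : ∀ a, 0 ≤ q a)
    (hp1 : ∑ a, p a = 1) (hq1 : ∑ a, q a ≤ 1) (hpq : ∀ a, 0 < p a → 0 < q a) :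
    ∑ a, Real.negMulLog (p a) ≤ ∑ a, p a * (- Real.log (q a)) := by
  have key : ∀ a, Real.negMulLog (p a) ≤ p a * (- Real.log (q a)) + (q a - p a) := by
    intro a
    rcases (hp a).eq_or_lt with h | h
    · rw [← h]; simp [hq a]
    · have hqa := hpq a h
      have h1 := Real.log_le_sub_one_of_pos (div_pos hqa h)
      rw [Real.log_div hqa.ne' h.ne'] at h1
      have h2 := mul_le_mul_of_nonneg_left h1 h.le
      have h3 : p a * (q a / p a - 1) = q a - p a := by field_simp
      rw [h3] at h2
      unfold Real.negMulLog
      linarith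
  have := Finset.sum_le_sum (s := Finset.univ) (fun a _ => key a)
  rw [Finset.sum_add_distrib, Finset.sum_sub_distrib] at this
  linarith

section ent
variable {X : Type*} [MeasurableSpace X] {μ : Measure X} [IsProbabilityMeasure μ]

lemma sum_fiber {γ : Type*} [Fintype γ] (h : X → γ)
    (hh : ∀ c, MeasurableSet (h ⁻¹' {c})) (s : Finset γ) (A : Set X) (hA : MeasurableSet A) :
    ∑ c ∈ s, μ.real (A ∩ h ⁻¹' {c}) = μ.real (A ∩ {x | h x ∈ s}) := by
  rw [← measureReal_biUnion_finset]
  · congr 1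
    ext x
    simp
  · intro a _ b _ hab
    rw [Function.onFun, Set.disjoint_left]
    rintro x ⟨_, hx⟩ ⟨_, hx'⟩
    exact hab (hx.symm.trans hx')
  · intro c _
    exact hA.inter (hh c)

lemma sum_fiber_univ {γ : Type*} [Fintype γ] (h : X → γ)
    (hh : ∀ c, MeasurableSet (h ⁻¹' {c})) (A : Set X) (hA : MeasurableSet A) :
    ∑ c, μ.real (A ∩ h ⁻¹' {c}) = μ.real A := by
  rw [sum_fiber h hh _ A hA]; simp

lemma sum_fiber_one {γ : Type*} [Fintype γ] (h : X → γ)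
    (hh : ∀ c, MeasurableSet (h ⁻¹' {c})) :
    ∑ c, μ.real (h ⁻¹' {c}) = 1 := by
  have := sum_fiber_univ (μ := μ) h hh Set.univ MeasurableSet.univ
  simpa using this

lemma Hf_key {α γ : Type*} [Fintype α] [Fintype γ] (f : X → α) (h : X → γ)
    (hf : ∀ c, MeasurableSet (f ⁻¹' {c})) (hh : ∀ c, MeasurableSet (h ⁻¹' {c}))
    (N : γ → ℝ) (hN : ∀ c, 0 < N c)
    (hcard : ∀ c, ∃ s : Finset α, (s.card : ℝ) ≤ N c ∧ ∀ x, h x = c → f x ∈ s) :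
    Hf μ f ≤ Hf μ h + ∑ c, μ.real (h ⁻¹' {c}) * Real.log (N c) := by
  classical
  choose s hs hsx using hcard
  set q : α → ℝ := fun a => ∑ c, if a ∈ s c then μ.real (h ⁻¹' {c}) / N c else 0 with hq
  have hterm : ∀ a c, 0 ≤ (if a ∈ s c then μ.real (h ⁻¹' {c}) / N c else 0) := by
    intro a c
    split_ifs
    · exact div_nonneg measureReal_nonneg (hN c).le
    · exact le_rfl
  have hqle : ∀ a c, a ∈ s c → μ.real (h ⁻¹' {c}) / N c ≤ q a := by
    intro a c hac
    have := Finset.single_le_sum (f := fun c => if a ∈ s c then μ.real (h ⁻¹' {c}) / N c else 0)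
      (fun c _ => hterm a c) (Finset.mem_univ c)
    simpa [hac] using this
  have hpos : ∀ a c, 0 < μ.real (f ⁻¹' {a} ∩ h ⁻¹' {c}) →
      a ∈ s c ∧ 0 < μ.real (h ⁻¹' {c}) := by
    intro a c hac
    refine ⟨?_, hac.trans_le (measureReal_mono Set.inter_subset_right)⟩
    have : (f ⁻¹' {a} ∩ h ⁻¹' {c}).Nonempty := by
      by_contra hne
      rw [Set.not_nonempty_iff_eq_empty] at hne
      rw [hne] at hac
      simp at hac
    obtain ⟨x, hx1, hx2⟩ := this
    have := hsx c x hx2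
    rw [Set.mem_preimage, Set.mem_singleton_iff] at hx1
    rwa [hx1] at this
  have hq1 : ∑ a, q a ≤ 1 := by
    rw [hq, Finset.sum_comm, ← sum_fiber_one (μ := μ) h hh]
    refine Finset.sum_le_sum fun c _ => ?_
    rw [← Finset.sum_filter, Finset.sum_const, nsmul_eq_mul]
    have e : (Finset.univ.filter fun a => a ∈ s c) = s c := by ext; simp
    rw [e]
    rw [mul_div_assoc', div_le_iff₀ (hN c), mul_comm]
    exact mul_le_mul_of_nonneg_left (hs c) measureReal_nonneg
  have G := gibbs (fun a => μ.real (f ⁻¹' {a})) q (fun a => measureReal_nonneg)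
    (fun a => Finset.sum_nonneg fun c _ => hterm a c) (sum_fiber_one f hf) hq1 (by
      intro a ha
      rw [← sum_fiber_univ h hh _ (hf a)] at ha
      obtain ⟨c, -, hc⟩ := Finset.exists_lt_of_sum_lt
        (f := fun _ : γ => (0:ℝ)) (s := Finset.univ) (by simpa using ha)
      obtain ⟨h1, h2⟩ := hpos a c hc
      exact (div_pos h2 (hN c)).trans_le (hqle a c h1))
  refine G.trans ?_
  have e1 : ∑ a, μ.real (f ⁻¹' {a}) * -Real.log (q a)
      = ∑ a, ∑ c, μ.real (f ⁻¹' {a} ∩ h ⁻¹' {c}) * -Real.log (q a) := by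
    refine Finset.sum_congr rfl fun a _ => ?_
    rw [← Finset.sum_mul, sum_fiber_univ h hh _ (hf a)]
  have e2 : Hf μ h + ∑ c, μ.real (h ⁻¹' {c}) * Real.log (N c)
      = ∑ a, ∑ c, μ.real (f ⁻¹' {a} ∩ h ⁻¹' {c}) *
        (Real.log (N c) - Real.log (μ.real (h ⁻¹' {c}))) := by
    rw [Finset.sum_comm, Hf, ← Finset.sum_add_distrib]
    refine Finset.sum_congr rfl fun c _ => ?_
    rw [← Finset.sum_mul]
    have : ∑ a, μ.real (f ⁻¹' {a} ∩ h ⁻¹' {c}) = μ.real (h ⁻¹' {c}) := by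
      simp_rw [Set.inter_comm _ (h ⁻¹' {c})]
      exact sum_fiber_univ f hf _ (hh c)
    rw [this, Real.negMulLog]; ring
  rw [e1, e2]
  refine Finset.sum_le_sum fun a _ => Finset.sum_le_sum fun c _ => ?_
  rcases (measureReal_nonneg (μ := μ) (s := f ⁻¹' {a} ∩ h ⁻¹' {c})).eq_or_lt with h0 | h0
  · rw [← h0]; simp
  · obtain ⟨h1, h2⟩ := hpos a c h0
    refine mul_le_mul_of_nonneg_left ?_ h0.le
    have := Real.log_le_log (div_pos h2 (hN c)) (hqle a c h1)
    rw [Real.log_div h2.ne' (hN c).ne'] at this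
    linarith

lemma meas_pair {α γ : Type*} (f : X → α) (h : X → γ)
    (hf : ∀ c, MeasurableSet (f ⁻¹' {c})) (hh : ∀ c, MeasurableSet (h ⁻¹' {c})) (c : α × γ) :
    MeasurableSet ((fun x => (f x, h x)) ⁻¹' {c}) := by
  have : (fun x => (f x, h x)) ⁻¹' {c} = f ⁻¹' {c.1} ∩ h ⁻¹' {c.2} := by
    ext x; simp [Prod.ext_iff]
  rw [this]
  exact (hf _).inter (hh _)

lemma Hf_pair {α γ : Type*} [Fintype α] [Fintype γ] (f : X → α) (h : X → γ)
    (hf : ∀ c, MeasurableSet (f ⁻¹' {c})) (hh : ∀ c, MeasurableSet (h ⁻¹' {c})) :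
    Hf μ (fun x => (f x, h x)) ≤ Hf μ f + Hf μ h := by
  have epre : ∀ c : α × γ, (fun x => (f x, h x)) ⁻¹' {c} = f ⁻¹' {c.1} ∩ h ⁻¹' {c.2} := by
    intro c; ext x; simp [Prod.ext_iff]
  have hle : ∀ c : α × γ, μ.real ((fun x => (f x, h x)) ⁻¹' {c}) ≤ μ.real (f ⁻¹' {c.1}) ∧
      μ.real ((fun x => (f x, h x)) ⁻¹' {c}) ≤ μ.real (h ⁻¹' {c.2}) := by
    intro c
    rw [epre]
    exact ⟨measureReal_mono Set.inter_subset_left, measureReal_mono Set.inter_subset_right⟩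
  have G := gibbs (fun c : α × γ => μ.real ((fun x => (f x, h x)) ⁻¹' {c}))
    (fun c => μ.real (f ⁻¹' {c.1}) * μ.real (h ⁻¹' {c.2}))
    (fun a => measureReal_nonneg) (fun a => by positivity)
    (sum_fiber_one _ (meas_pair f h hf hh))
    (by
      rw [Fintype.sum_prod_type]
      simp_rw [← Finset.mul_sum]
      rw [← Finset.sum_mul, sum_fiber_one f hf, sum_fiber_one h hh]; simp)
    (fun c hc => mul_pos (hc.trans_le (hle c).1) (hc.trans_le (hle c).2))
  refine G.trans (le_of_eq ?_)
  have e : ∀ c : α × γ, μ.real ((fun x => (f x, h x)) ⁻¹' {c}) *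
      -Real.log (μ.real (f ⁻¹' {c.1}) * μ.real (h ⁻¹' {c.2})) =
      μ.real (f ⁻¹' {c.1} ∩ h ⁻¹' {c.2}) * -Real.log (μ.real (f ⁻¹' {c.1})) +
      μ.real (f ⁻¹' {c.1} ∩ h ⁻¹' {c.2}) * -Real.log (μ.real (h ⁻¹' {c.2})) := by
    intro c
    rw [epre]
    rcases (measureReal_nonneg (μ := μ) (s := f ⁻¹' {c.1} ∩ h ⁻¹' {c.2})).eq_or_lt with h0 | h0
    · rw [← h0]; simp
    · rw [← epre] at h0
      rw [Real.log_mul (h0.trans_le (hle c).1).ne' (h0.trans_le (hle c).2).ne']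
      ring
  simp_rw [e]
  rw [Finset.sum_add_distrib]
  congr 1
  · rw [Fintype.sum_prod_type, Hf]
    refine Finset.sum_congr rfl fun a _ => ?_
    simp only
    rw [← Finset.sum_mul, sum_fiber_univ h hh _ (hf a), Real.negMulLog]; ring
  · rw [Fintype.sum_prod_type, Finset.sum_comm, Hf]
    refine Finset.sum_congr rfl fun c _ => ?_
    simp only
    rw [← Finset.sum_mul]
    simp_rw [Set.inter_comm _ (h ⁻¹' {c})]
    rw [sum_fiber_univ f hf _ (hh c), Real.negMulLog]; ring

lemma Hf_equiv {α γ : Type*} [Fintype α] [Fintype γ] (e : α ≃ γ) (f : X → α) :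
    Hf μ (fun x => e (f x)) = Hf μ f := by
  unfold Hf
  rw [← Equiv.sum_comp e]
  refine Finset.sum_congr rfl fun a _ => ?_
  congr 2
  ext x
  simp

lemma Hf_comp {α : Type*} [Fintype α] (f : X → α) (hf : ∀ c, MeasurableSet (f ⁻¹' {c}))
    (R : X → X) (hR : MeasurePreserving R μ μ) :
    Hf μ (fun x => f (R x)) = Hf μ f := by
  unfold Hf
  refine Finset.sum_congr rfl fun a _ => ?_
  congr 1
  have : (fun x => f (R x)) ⁻¹' {a} = R ⁻¹' (f ⁻¹' {a}) := rfl
  rw [this, measureReal_def, hR.measure_preimage (hf a).nullMeasurableSet, measureReal_def]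

lemma nm_meas {ι : Type*} {T : X → X} (hT : Measurable T) (p : X → ι)
    (hp : ∀ c, MeasurableSet (p ⁻¹' {c})) (n : ℕ) (c : Fin n → ι) :
    MeasurableSet (nm T p n ⁻¹' {c}) := by
  have : nm T p n ⁻¹' {c} = ⋂ i : Fin n, T^[(i : ℕ)] ⁻¹' (p ⁻¹' {c i}) := by
    ext x
    simp [nm, funext_iff]
  rw [this]
  exact MeasurableSet.iInter fun i => (hT.iterate i) (hp _)

lemma Hf_nm_add {ι : Type*} [Fintype ι] {T : X → X} (hT : MeasurePreserving T μ μ) (p : X → ι)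
    (hp : ∀ c, MeasurableSet (p ⁻¹' {c})) (a b : ℕ) :
    Hf μ (nm T p (a + b)) ≤ Hf μ (nm T p a) + Hf μ (nm T p b) := by
  have h1 : nm T p (a + b) = fun x => Fin.appendEquiv a b (nm T p a x, nm T p b (T^[a] x)) := by
    funext x
    rw [← Equiv.symm_apply_eq]
    refine Prod.ext ?_ ?_
    · funext i; simp [Fin.appendEquiv, nm]
    · funext i; simp [Fin.appendEquiv, nm, ← Function.iterate_add_apply, add_comm]
  rw [h1, Hf_equiv]
  refine (Hf_pair _ _ (nm_meas hT.measurable p hp a) ?_).trans ?_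
  · intro c
    exact (hT.measurable.iterate a) (nm_meas hT.measurable p hp b c)
  · rw [Hf_comp _ (nm_meas hT.measurable p hp b) _ (hT.iterate a)]

lemma Hf_nm_mul {ι : Type*} [Fintype ι] {T : X → X} (hT : MeasurePreserving T μ μ) (p : X → ι)
    (hp : ∀ c, MeasurableSet (p ⁻¹' {c})) (m k : ℕ) :
    Hf μ (nm T p (m * k)) ≤ m * Hf μ (nm T p k) := by
  induction m with
  | zero =>
    have h0 : Hf μ (nm T p (0 * k)) ≤ 0 := by
      rw [zero_mul]
      unfold Hf
      refine Finset.sum_nonpos fun i _ => ?_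
      have : nm T p 0 ⁻¹' {i} = Set.univ := by
        ext x; simp [Subsingleton.elim _ i]
      rw [this]; simp
    simpa using h0
  | succ m ih =>
    rw [Nat.succ_mul]
    have := Hf_nm_add hT p hp (m * k) k
    push_cast
    linarith

end ent

/-- All points of `D` stay pairwise `V`-close up to time `n`. -/
def DynSmall {X : Type*} (T : X → X) (V : Set (X × X)) (n : ℕ) (D : Set X) : Prop :=
  ∀ x ∈ D, ∀ x' ∈ D, ∀ i < n, (T^[i] x, T^[i] x') ∈ V

section fiber
open scoped Uniformity Topology
variable {X Y : Type*} [MetricSpace X] [CompactSpace X] [MetricSpace Y] [CompactSpace Y]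

lemma fiber_local (T : X → X) (hT : Continuous T)
    (π : X → Y) (hπ : Continuous π) (y : Y)
    (hfib : coverEntropy T (π ⁻¹' {y}) = 0) (V : Set (X × X)) (hV : V ∈ 𝓤 X)
    (ε : ℝ) (hε : 0 < ε) :
    ∃ W : Set Y, IsOpen W ∧ y ∈ W ∧ ∃ n : ℕ, 1 ≤ n ∧ ∃ F : Finset (Set X),
      (F.card : ℝ) ≤ Real.exp (ε * n) ∧ π ⁻¹' W ⊆ ⋃₀ (F : Set (Set X)) ∧
      ∀ D ∈ F, DynSmall T V n D := by
  classical
  obtain ⟨U, hU, hUo, hUs, hUV⟩ := comp_open_symm_mem_uniformity_sets hV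
  have h1 : coverEntropyEntourage T (π ⁻¹' {y}) U < ((ε : ℝ) : EReal) := by
    refine (coverEntropyEntourage_le_coverEntropy T _ hU).trans_lt ?_
    rw [hfib]
    exact_mod_cast hε
  have h2 := ExpGrowth.eventually_le_exp h1
  obtain ⟨n, hn, hn1⟩ := (h2.and (Filter.eventually_ge_atTop 1)).exists
  have hex : EReal.exp ((ε : EReal) * (n : EReal)) = ENNReal.ofReal (Real.exp (ε * n)) := by
    have : ((ε : EReal) * (n : EReal)) = ((ε * n : ℝ) : EReal) := by
      push_cast; rfl
    rw [this, EReal.exp_coe]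
  rw [hex] at hn
  have hfin : coverMincard T (π ⁻¹' {y}) U n < ⊤ := by
    rw [lt_top_iff_ne_top]
    intro htop
    rw [htop] at hn
    simp at hn
  obtain ⟨s, hs, hcard⟩ := (coverMincard_finite_iff T _ U n).1 hfin
  rw [← hcard] at hn
  have hcard' : (s.card : ℝ) ≤ Real.exp (ε * n) := by
    have : ((s.card : ℕ) : ENNReal) ≤ ENNReal.ofReal (Real.exp (ε * n)) := by simpa using hn
    rw [← ENNReal.ofReal_natCast] at this
    exact (ENNReal.ofReal_le_ofReal_iff (Real.exp_pos _).le).1 this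
  set B : X → Set X := fun z => UniformSpace.ball z (dynEntourage T U n) with hB
  have hBo : ∀ z, IsOpen (B z) := fun z =>
    UniformSpace.isOpen_ball z (isOpen.dynEntourage hT hUo n)
  have hO : IsOpen (⋃ z ∈ s, B z) := isOpen_biUnion fun z _ => hBo z
  have hclosed : IsClosedMap π := hπ.isClosedMap
  refine ⟨Set.kernImage π (⋃ z ∈ s, B z), isClosedMap_iff_kernImage.1 hclosed hO, ?_, n, hn1,
    s.image B, ?_, ?_, ?_⟩
  · intro x hx
    obtain ⟨z, hz, hxz⟩ := hs (show x ∈ π ⁻¹' {y} from hx)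
    refine Set.mem_biUnion hz ?_
    exact (dynEntourage T U n).symm hxz
  · exact le_trans (by exact_mod_cast Finset.card_image_le) hcard'
  · intro x hx
    have := hx (rfl : π x = π x)
    simpa using this
  · intro D hD
    obtain ⟨z, hz, rfl⟩ := Finset.mem_image.1 hD
    intro x hx x' hx' i hi
    have a1 := (mem_ball_dynEntourage.1 hx) i hi
    have a2 := (mem_ball_dynEntourage.1 hx') i hi
    exact hUV ⟨T^[i] z, SetRel.symm U a1, a2⟩

lemma iterate_semi {X Y : Type*} {T : X → X} {S : Y → Y} {π : X → Y} (hsemi : π ∘ T = S ∘ π)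
    (i : ℕ) (x : X) : π (T^[i] x) = S^[i] (π x) :=
  (Function.Semiconj.iterate_right (f := π) (ga := T) (gb := S)
    (fun x => congrFun hsemi x) i) x

lemma fiber_cover [MeasurableSpace Y] [BorelSpace Y] (T : X → X) (hT : Continuous T)
    (π : X → Y) (hπ : Continuous π)
    (hfib : ∀ y : Y, coverEntropy T (π ⁻¹' {y}) = 0) (V : Set (X × X)) (hV : V ∈ 𝓤 X)
    (ε : ℝ) (hε : 0 < ε) :
    ∃ Q : Finset (Set Y), IsFinPartition Q ∧ ∃ M : ℕ, ∀ n : ℕ, ∀ c : ℕ → Set Y,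
      (∀ i < n, c i ∈ Q) → ∃ F : Finset (Set X), (F.card : ℝ) ≤ Real.exp (ε * (n + M)) ∧
        {x | ∀ i < n, π (T^[i] x) ∈ c i} ⊆ ⋃₀ (F : Set (Set X)) ∧
        ∀ D ∈ F, DynSmall T V n D := by
  classical
  choose W hWo hyW t ht F hFc hFW hFD using
    fun y => fiber_local T hT π hπ y (hfib y) V hV ε hε
  obtain ⟨s, hs⟩ := isCompact_univ.elim_finite_subcover W hWo
    (fun y _ => Set.mem_iUnion.2 ⟨y, hyW y⟩)
  set M : ℕ := s.sup t with hM
  -- the partition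
  set pat : Y → (s → Prop) := fun y a => y ∈ W a with hpat
  have hpatm : Measurable pat := by
    refine measurable_pi_lambda _ fun a => ?_
    exact measurableSet_setOfPred.1 (hWo a).measurableSet
  set Q : Finset (Set Y) := Finset.univ.image (fun b : s → Prop => pat ⁻¹' {b}) with hQ
  have hQW : ∀ C ∈ Q, C.Nonempty → ∃ a ∈ s, C ⊆ W a := by
    intro C hC ⟨y, hy⟩
    obtain ⟨b, -, rfl⟩ := Finset.mem_image.1 hC
    obtain ⟨a, ha, hya⟩ := Set.mem_iUnion₂.1 (hs (Set.mem_univ y))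
    refine ⟨a, ha, fun z hz => ?_⟩
    have h1 : pat z = pat y := hz.trans hy.symm
    have h2 := congrFun h1 ⟨a, ha⟩
    exact h2.mpr hya
  refine ⟨Q, ⟨?_, ?_, ?_⟩, M, ?_⟩
  · intro A hA
    obtain ⟨b, -, rfl⟩ := Finset.mem_image.1 hA
    exact hpatm (MeasurableSet.singleton b)
  · refine Set.eq_univ_of_forall fun y => ?_
    exact ⟨pat ⁻¹' {pat y}, by simp [hQ], rfl⟩
  · intro A hA B hB hAB
    obtain ⟨b, -, rfl⟩ := Finset.mem_image.1 hA
    obtain ⟨b', -, rfl⟩ := Finset.mem_image.1 hB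
    rw [← Set.disjoint_iff_inter_eq_empty, Set.disjoint_left]
    intro y hy hy'
    exact hAB (by rw [← (hy : pat y = b), ← (hy' : pat y = b')])
  · intro n
    induction n using Nat.strong_induction_on with
    | _ n ih =>
      intro c hc
      rcases Nat.eq_zero_or_pos n with rfl | hn
      · refine ⟨{Set.univ}, ?_, ?_, ?_⟩
        · simp only [Finset.card_singleton, Nat.cast_one]
          exact Real.one_le_exp (by positivity)
        · simp
        · intro D _ x _ x' _ i hi
          omega
      · rcases (c 0).eq_empty_or_nonempty with he | hne
        · refine ⟨∅, ?_, ?_, by simp⟩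
          · simpa using (Real.exp_pos _).le
          · intro x hx
            have := hx 0 hn
            rw [he] at this
            exact this.elim
        obtain ⟨a, has, hca⟩ := hQW (c 0) (hc 0 hn) hne
        have htM : t a ≤ M := Finset.le_sup has
        rcases le_or_gt n (t a) with hle | hlt
        · refine ⟨F a, (hFc a).trans ?_, ?_, ?_⟩
          · refine Real.exp_le_exp.2 (mul_le_mul_of_nonneg_left ?_ hε.le)
            have : (t a : ℝ) ≤ M := by exact_mod_cast htM
            have : (0 : ℝ) ≤ n := by positivity
            linarith
          · intro x hx
            exact hFW a (hca (hx 0 hn))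
          · intro D hD x hx x' hx' i hi
            exact hFD a D hD x hx x' hx' i (hi.trans_le hle)
        · obtain ⟨F', hF'c, hF'W, hF'D⟩ := ih (n - t a) (by have := ht a; omega)
            (fun i => c (i + t a)) (fun i hi => hc _ (by omega))
          refine ⟨Finset.image₂ (fun D D' => D ∩ T^[t a] ⁻¹' D') (F a) F', ?_, ?_, ?_⟩
          · have h1 : ((Finset.image₂ (fun D D' => D ∩ T^[t a] ⁻¹' D') (F a) F').card : ℝ)
                ≤ (F a).card * F'.card := by
              exact_mod_cast Finset.card_image₂_le _ _ _
            refine h1.trans ((mul_le_mul (hFc a) hF'c (by positivity) (Real.exp_pos _).le).trans ?_)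
            rw [← Real.exp_add]
            refine Real.exp_le_exp.2 (le_of_eq ?_)
            rw [Nat.cast_sub hlt.le]
            ring
          · intro x hx
            obtain ⟨D, hD, hxD⟩ := hFW a (hca (hx 0 hn) : x ∈ π ⁻¹' W a)
            have : T^[t a] x ∈ {x | ∀ i < n - t a, π (T^[i] x) ∈ c (i + t a)} := by
              intro i hi
              rw [← Function.iterate_add_apply]
              exact hx _ (by omega)
            obtain ⟨D', hD', hxD'⟩ := hF'W this
            exact ⟨D ∩ T^[t a] ⁻¹' D', Finset.mem_image₂_of_mem hD hD', hxD, hxD'⟩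
          · intro E hE x hx x' hx' i hi
            obtain ⟨D, hD, D', hD', rfl⟩ := Finset.mem_image₂.1 hE
            rcases lt_or_ge i (t a) with hi' | hi'
            · exact hFD a D hD x hx.1 x' hx'.1 i hi'
            · have := hF'D D' hD' _ hx.2 _ hx'.2 (i - t a) (by omega)
              rw [← Function.iterate_add_apply, ← Function.iterate_add_apply,
                Nat.sub_add_cancel hi'] at this
              exact this

end fiber

section trans
variable {X : Type*} [MeasurableSpace X]

lemma exists_cell {P : Finset (Set X)} (hP : IsFinPartition P) :
    ∃ p : X → {A // A ∈ P}, (∀ x A, p x = A ↔ x ∈ (A : Set X)) ∧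
      ∀ A, MeasurableSet (p ⁻¹' {A}) := by
  have : ∀ x : X, ∃ A : {A // A ∈ P}, x ∈ (A : Set X) := by
    intro x
    have hx : x ∈ ⋃₀ (P : Set (Set X)) := by rw [hP.2.1]; trivial
    obtain ⟨A, hA, hxA⟩ := hx
    exact ⟨⟨A, hA⟩, hxA⟩
  choose p hp using this
  have h1 : ∀ x A, p x = A ↔ x ∈ (A : Set X) := by
    intro x A
    refine ⟨fun h => h ▸ hp x, fun h => ?_⟩
    by_contra hne
    have := hP.2.2 (p x) (p x).2 A A.2 (fun h => hne (Subtype.ext h))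
    exact Set.notMem_empty x (this ▸ ⟨hp x, h⟩)
  refine ⟨p, h1, fun A => ?_⟩
  have : p ⁻¹' {A} = A := by ext x; simp [h1]
  rw [this]
  exact hP.1 A A.2

lemma partInfo_eq (μ : Measure X) (T : X → X) {P : Finset (Set X)} (p : X → {A // A ∈ P})
    (hp : ∀ x A, p x = A ↔ x ∈ (A : Set X)) (n : ℕ) :
    partInfo μ (joinPart T P n) = Hf μ (nm T p n) := by
  classical
  have e : ∀ f : Fin n → {A // A ∈ P},
      (⋂ i : Fin n, T^[(i : ℕ)] ⁻¹' (f i : Set X)) = nm T p n ⁻¹' {f} := by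
    intro f
    ext x
    simp [nm, funext_iff, hp]
  unfold partInfo joinPart Hf
  simp_rw [e]
  rw [Finset.sum_image_of_pairwise_eq_zero]
  · rfl
  · intro f _ g _ hfg heq
    have : nm T p n ⁻¹' {f} = ∅ := by
      refine Set.eq_empty_of_forall_notMem fun x hx => ?_
      have hx' : x ∈ nm T p n ⁻¹' {g} := by
        have h2 : nm T p n ⁻¹' {f} = nm T p n ⁻¹' {g} := heq
        rw [← h2]; exact hx
      exact hfg ((hx : nm T p n x = f).symm.trans hx')
    rw [this]; simp

lemma Hf_nonneg {ι : Type*} [Fintype ι] (μ : Measure X) [IsProbabilityMeasure μ] (f : X → ι) :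
    0 ≤ Hf μ f :=
  Finset.sum_nonneg fun _ _ => Real.negMulLog_nonneg measureReal_nonneg measureReal_le_one

lemma Hf_map {Y ι : Type*} [MeasurableSpace Y] [Fintype ι] (μ : Measure X) {T : X → X} {S : Y → Y}
    {π : X → Y} (hπ : Measurable π) (hS : Measurable S) (hsemi : π ∘ T = S ∘ π) (q : Y → ι)
    (hq : ∀ c, MeasurableSet (q ⁻¹' {c})) (n : ℕ) :
    Hf μ (nm T (fun x => q (π x)) n) = Hf (μ.map π) (nm S q n) := by
  unfold Hf
  refine Finset.sum_congr rfl fun c _ => ?_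
  congr 1
  rw [map_measureReal_apply hπ (nm_meas hS q hq n c)]
  congr 1
  ext x
  have : nm T (fun x => q (π x)) n x = nm S q n (π x) := by
    funext i
    simp [nm, iterate_semi hsemi]
  simp [this]

open Classical in
lemma entPart_pull {Y : Type*} [MeasurableSpace Y] (μ : Measure X) {T : X → X} {S : Y → Y}
    {π : X → Y} (hπ : Measurable π) (hS : Measurable S) (hsurj : Function.Surjective π)
    (hsemi : π ∘ T = S ∘ π) (Q : Finset (Set Y)) (hQ : IsFinPartition Q) :
    IsFinPartition (Q.image (fun A => π ⁻¹' A)) ∧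
    entPart μ T (Q.image (fun A => π ⁻¹' A)) = entPart (μ.map π) S Q := by
  refine ⟨⟨?_, ?_, ?_⟩, ?_⟩
  · intro A hA
    obtain ⟨B, hB, rfl⟩ := Finset.mem_image.1 hA
    exact hπ (hQ.1 B hB)
  · refine Set.eq_univ_of_forall fun x => ?_
    have hx : π x ∈ ⋃₀ (Q : Set (Set Y)) := by rw [hQ.2.1]; trivial
    obtain ⟨A, hA, hxA⟩ := hx
    exact ⟨π ⁻¹' A, Finset.mem_coe.2 (Finset.mem_image_of_mem _ hA), hxA⟩
  · intro A hA B hB hAB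
    obtain ⟨A', hA', rfl⟩ := Finset.mem_image.1 hA
    obtain ⟨B', hB', rfl⟩ := Finset.mem_image.1 hB
    rw [← Set.preimage_inter, hQ.2.2 A' hA' B' hB' (fun h => hAB (by rw [h])), Set.preimage_empty]
  · unfold entPart
    congr 1
    funext n
    congr 1
    have hj : joinPart T (Q.image (fun A => π ⁻¹' A)) (n + 1)
        = (joinPart S Q (n + 1)).image (fun A => π ⁻¹' A) := by
      ext A
      simp only [joinPart, Finset.mem_image, Finset.mem_univ, true_and]
      constructor
      · rintro ⟨f, rfl⟩
        choose g hg hgf using fun i => Finset.mem_image.1 (f i).2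
        refine ⟨_, ⟨fun i => ⟨g i, hg i⟩, rfl⟩, ?_⟩
        ext x
        simp [← hgf, iterate_semi hsemi]
      · rintro ⟨B, ⟨f, rfl⟩, rfl⟩
        refine ⟨fun i => ⟨π ⁻¹' (f i), Finset.mem_image_of_mem _ (f i).2⟩, ?_⟩
        ext x
        simp [iterate_semi hsemi]
    rw [hj]
    unfold partInfo
    rw [Finset.sum_image (fun A _ B _ h => hsurj.preimage_injective h)]
    refine Finset.sum_congr rfl fun A hA => ?_
    rw [Measure.map_apply hπ]
    simp only [joinPart, Finset.mem_image, Finset.mem_univ, true_and] at hA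
    obtain ⟨f, rfl⟩ := hA
    exact MeasurableSet.iInter fun i => (hS.iterate i) (hQ.1 _ (f i).2)

end trans

section mainineq
open scoped Uniformity Topology
variable {X Y : Type*}
    [MetricSpace X] [CompactSpace X] [MeasurableSpace X] [BorelSpace X]
    [MetricSpace Y] [CompactSpace Y] [MeasurableSpace Y] [BorelSpace Y]

lemma exists_delta (K ε : ℝ) (hε : 0 < ε) : ∃ δ > 0, ∀ t : ℝ, 0 ≤ t → t < δ →
    Real.negMulLog t + Real.negMulLog (1 - t) + t * Real.log K < ε := by
  have hc : Continuous fun t : ℝ =>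
      Real.negMulLog t + Real.negMulLog (1 - t) + t * Real.log K := by
    have := Real.continuous_negMulLog
    fun_prop
  have h0 := hc.tendsto 0
  simp only [Real.negMulLog_zero, sub_zero, Real.negMulLog_one, zero_mul, add_zero] at h0
  obtain ⟨δ, hδ, h⟩ := Metric.eventually_nhds_iff.1 (h0.eventually_lt_const hε)
  refine ⟨δ, hδ, fun t ht ht' => h ?_⟩
  rw [Real.dist_eq, sub_zero, abs_of_nonneg ht]
  exact ht'

/-- Approximation of a partition from inside by closed sets. -/
lemma exists_approx (μ : Measure X) [IsProbabilityMeasure μ] {P : Finset (Set X)}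
    (hP : IsFinPartition P) (p : X → {A // A ∈ P}) (hp : ∀ x A, p x = A ↔ x ∈ (A : Set X))
    (δ : ℝ) (hδ : 0 < δ) :
    ∃ B : Set X, MeasurableSet B ∧ μ.real B < δ ∧ ∃ V ∈ 𝓤 X, ∀ x x', (x, x') ∈ V →
      x ∉ B → x' ∉ B → p x = p x' := by
  classical
  have hK : (0 : ℝ) < P.card + 1 := by positivity
  have h1 : ∀ A : {A // A ∈ P}, ∃ F ⊆ (A : Set X), IsClosed F ∧
      μ ((A : Set X) \ F) < ENNReal.ofReal (δ / (P.card + 1)) := by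
    intro A
    obtain ⟨F, hF, hFc, hFl⟩ := (hP.1 A A.2).exists_isClosed_sdiff_lt (μ := μ)
      (measure_ne_top _ _)
      (ε := ENNReal.ofReal (δ / (P.card + 1))) (by simpa using div_pos hδ hK)
    exact ⟨F, hF, hFc, hFl⟩
  choose b hbA hbc hbl using h1
  refine ⟨(⋃ A, b A)ᶜ, (isClosed_iUnion_of_finite hbc).measurableSet.compl, ?_,
    (⋃ A, ⋃ A', ⋃ _ : A ≠ A', b A ×ˢ b A')ᶜ, ?_, ?_⟩
  · have hsub : (⋃ A, b A)ᶜ ⊆ ⋃ A ∈ (Finset.univ : Finset {A // A ∈ P}), (A : Set X) \ b A := by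
      intro x hx
      simp only [Set.mem_compl_iff, Set.mem_iUnion, not_exists] at hx
      simp only [Set.mem_iUnion]
      exact ⟨p x, Finset.mem_univ _, (hp x _).1 rfl, hx _⟩
    have h2 : μ.real (⋃ A, b A)ᶜ ≤ ∑ A : {A // A ∈ P}, μ.real ((A : Set X) \ b A) :=
      (measureReal_mono hsub (measure_ne_top _ _)).trans (measureReal_biUnion_finset_le _ _)
    have h3 : ∑ A : {A // A ∈ P}, μ.real ((A : Set X) \ b A)
        ≤ ∑ A : {A // A ∈ P}, δ / (P.card + 1) := by
      refine Finset.sum_le_sum fun A _ => ?_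
      exact (ENNReal.toReal_le_of_le_ofReal (div_pos hδ hK).le (hbl A).le)
    refine (h2.trans h3).trans_lt ?_
    rw [Finset.sum_const, nsmul_eq_mul, Finset.card_univ, Fintype.card_coe, mul_div_assoc',
      div_lt_iff₀ hK]
    nlinarith
  · rw [← nhdsSet_diagonal_eq_uniformity]
    refine IsOpen.mem_nhdsSet ?_ |>.2 ?_
    · rw [isOpen_compl_iff]
      refine isClosed_iUnion_of_finite fun A => isClosed_iUnion_of_finite fun A' =>
        isClosed_iUnion_of_finite fun _ => (hbc A).prod (hbc A')
    · rintro ⟨x, x'⟩ hx hx'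
      obtain rfl : x = x' := hx
      simp only [Set.mem_iUnion, Set.mem_prod] at hx'
      obtain ⟨A, A', hne, h1, h2⟩ := hx'
      exact hne (((hp x A).2 (hbA A h1)).symm.trans ((hp x A').2 (hbA A' h2)))
  · intro x x' hV hx hx'
    simp only [Set.mem_compl_iff, not_not, Set.mem_iUnion] at hx hx'
    obtain ⟨A, hA⟩ := hx
    obtain ⟨A', hA'⟩ := hx'
    rw [(hp x A).2 (hbA A hA), (hp x' A').2 (hbA A' hA')]
    by_contra hne
    refine hV ?_
    simp only [Set.mem_iUnion]
    exact ⟨A, A', hne, hA, hA'⟩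

lemma entPart_le (μ : Measure X) [IsProbabilityMeasure μ] (T : X → X) {P : Finset (Set X)}
    (hP : IsFinPartition P) (n : ℕ) (hn : 0 < n) :
    entPart μ T P ≤ partInfo μ (joinPart T P n) / n := by
  obtain ⟨p, hp, -⟩ := exists_cell hP
  obtain ⟨m, rfl⟩ : ∃ m, n = m + 1 := ⟨n - 1, by omega⟩
  unfold entPart
  have := ciInf_le (f := fun n : ℕ => partInfo μ (joinPart T P (n + 1)) / ((n : ℝ) + 1)) ?_ m
  · simpa using this
  · refine ⟨0, ?_⟩
    rintro _ ⟨k, rfl⟩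
    simp only
    rw [partInfo_eq μ T p hp]
    exact div_nonneg (Hf_nonneg μ _) (by positivity)

lemma main_count {ι κ : Type*} [Fintype ι] [Fintype κ] [DecidableEq ι] (μ : Measure X) [IsProbabilityMeasure μ]
    {T : X → X} (hT : MeasurePreserving T μ μ)
    (p : X → ι) (hp : ∀ c, MeasurableSet (p ⁻¹' {c}))
    (g : X → κ) (hg : ∀ c, MeasurableSet (g ⁻¹' {c}))
    (r : X → Bool) (hr : ∀ c, MeasurableSet (r ⁻¹' {c})) (n : ℕ) (L : ℝ) (hL : 0 < L)
    (hK : 0 < Fintype.card ι)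
    (hcov : ∀ c : κ, ∃ F : Finset (Set X), (F.card : ℝ) ≤ L ∧
      g ⁻¹' {c} ⊆ ⋃₀ (F : Set (Set X)) ∧
      ∀ D ∈ F, ∀ x ∈ D, ∀ x' ∈ D, ∀ i < n, r (T^[i] x) = false → r (T^[i] x') = false →
        p (T^[i] x) = p (T^[i] x')) :
    Hf μ (nm T p n) ≤ Hf μ g + n * Hf μ r + Real.log L +
      n * (μ.real (r ⁻¹' {true}) * Real.log (Fintype.card ι)) := by
  classical
  set Z : (Fin n → Bool) → ℕ := fun b => (Finset.univ.filter fun i => b i = true).card with hZ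
  set h : X → κ × (Fin n → Bool) := fun x => (g x, nm T r n x) with hh
  have hrm := nm_meas hT.measurable r hr n
  have hhm : ∀ c, MeasurableSet (h ⁻¹' {c}) := meas_pair g _ hg hrm
  have hKR : (0 : ℝ) < Fintype.card ι := by exact_mod_cast hK
  have hkey := Hf_key (μ := μ) (nm T p n) h (nm_meas hT.measurable p hp n) hhm
    (fun c => L * (Fintype.card ι : ℝ) ^ (Z c.2)) (fun c => by positivity) (by
      intro c
      obtain ⟨F, hFc, hFs, hFD⟩ := hcov c.1
      refine ⟨F.biUnion fun D => if hD : ∃ x ∈ D, h x = c then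
        Fintype.piFinset (fun i => if c.2 i = true then Finset.univ else {nm T p n hD.choose i})
        else ∅, ?_, ?_⟩
      · have h1 : (F.biUnion fun D => if hD : ∃ x ∈ D, h x = c then
          Fintype.piFinset (fun i => if c.2 i = true then Finset.univ else {nm T p n hD.choose i})
          else ∅).card ≤ F.card * (Fintype.card ι) ^ (Z c.2) := by
          refine Finset.card_biUnion_le_card_mul _ _ _ fun D _ => ?_
          split_ifs with hD
          · rw [Fintype.card_piFinset]
            simp only [apply_ite Finset.card, Finset.card_univ, Finset.card_singleton]
            rw [Finset.prod_ite]
            simp [hZ]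
          · simp
        calc _ ≤ ((F.card * (Fintype.card ι) ^ (Z c.2) : ℕ) : ℝ) := by exact_mod_cast h1
          _ ≤ _ := by
            push_cast
            exact mul_le_mul_of_nonneg_right hFc (by positivity)
      · intro x hx
        have hxg : x ∈ g ⁻¹' {c.1} := congrArg Prod.fst hx
        obtain ⟨D, hDF, hxD⟩ := hFs hxg
        refine Finset.mem_biUnion.2 ⟨D, hDF, ?_⟩
        have hD : ∃ x ∈ D, h x = c := ⟨x, hxD, hx⟩
        rw [dif_pos hD, Fintype.mem_piFinset]
        intro i
        split_ifs with hi
        · simp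
        · rw [Finset.mem_singleton]
          obtain ⟨hz1, hz2⟩ := hD.choose_spec
          have e1 : r (T^[(i : ℕ)] x) = c.2 i := congrFun (congrArg Prod.snd hx) i
          have e2 : r (T^[(i : ℕ)] hD.choose) = c.2 i := congrFun (congrArg Prod.snd hz2) i
          simp only [Bool.not_eq_true] at hi
          exact hFD D hDF x hxD _ hz1 i i.2 (e1.trans hi) (e2.trans hi))
  have hpair : Hf μ h ≤ Hf μ g + Hf μ (nm T r n) := Hf_pair g _ hg hrm
  have hrn : Hf μ (nm T r n) ≤ n * Hf μ r := by
    have h1 := Hf_nm_mul hT r hr n 1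
    rw [mul_one] at h1
    have h2 : Hf μ (nm T r 1) = Hf μ r := by
      rw [← Hf_equiv (Equiv.funUnique (Fin 1) Bool) (nm T r 1)]
      rfl
    rwa [h2] at h1
  have hsum : ∑ c, μ.real (h ⁻¹' {c}) * Real.log (L * (Fintype.card ι : ℝ) ^ (Z c.2))
      = Real.log L + n * (μ.real (r ⁻¹' {true}) * Real.log (Fintype.card ι)) := by
    have e1 : ∀ c, μ.real (h ⁻¹' {c}) * Real.log (L * (Fintype.card ι : ℝ) ^ (Z c.2))
        = μ.real (h ⁻¹' {c}) * Real.log L +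
          (∑ i : Fin n, if c.2 i = true then μ.real (h ⁻¹' {c}) else 0)
            * Real.log (Fintype.card ι) := by
      intro c
      rw [Real.log_mul hL.ne' (by positivity), Real.log_pow, ← Finset.sum_filter,
        Finset.sum_const, nsmul_eq_mul]
      ring
    simp_rw [e1]
    rw [Finset.sum_add_distrib, ← Finset.sum_mul, sum_fiber_one h hhm, one_mul, ← Finset.sum_mul,
      Finset.sum_comm]
    have e2 : ∀ i : Fin n, (∑ c : κ × (Fin n → Bool),
        if c.2 i = true then μ.real (h ⁻¹' {c}) else 0) = μ.real (r ⁻¹' {true}) := by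
      intro i
      rw [← Finset.sum_filter]
      have := sum_fiber (μ := μ) h hhm
        (Finset.univ.filter fun c : κ × (Fin n → Bool) => c.2 i = true) Set.univ MeasurableSet.univ
      simp only [Set.univ_inter] at this
      rw [this]
      have e3 : {x | h x ∈ Finset.univ.filter fun c : κ × (Fin n → Bool) => c.2 i = true}
          = T^[(i : ℕ)] ⁻¹' (r ⁻¹' {true}) := by
        ext x
        simp [hh, nm]
      rw [e3, measureReal_def, (hT.iterate i).measure_preimage (hr true).nullMeasurableSet,
        measureReal_def]
    simp_rw [e2]
    simp
    ring
  rw [hsum] at hkey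
  linarith

lemma main_ineq (T : X → X) (S : Y → Y) (hT : Continuous T) (hS : Continuous S)
    (π : X → Y) (hπ : Continuous π)
    (hsemi : π ∘ T = S ∘ π)
    (hfib : ∀ y : Y, coverEntropy T (π ⁻¹' {y}) = 0)
    (μ : Measure X) [IsProbabilityMeasure μ] (hinv : MeasurePreserving T μ μ)
    (P : Finset (Set X)) (hP : IsFinPartition P) (ε : ℝ) (hε : 0 < ε) :
    ∃ Q : Finset (Set Y), IsFinPartition Q ∧
      entPart μ T P ≤ entPart (μ.map π) S Q + 4 * ε := by
  classical
  obtain ⟨p, hp, hpm⟩ := exists_cell hP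
  obtain ⟨δ, hδ, hδ'⟩ := exists_delta (Fintype.card {A // A ∈ P}) ε hε
  obtain ⟨B, hBm, hBδ, V, hV, hVB⟩ := exists_approx μ hP p hp δ hδ
  obtain ⟨Q, hQ, M, hM⟩ := fiber_cover T hT π hπ hfib V hV ε hε
  refine ⟨Q, hQ, ?_⟩
  obtain ⟨q, hq, hqm⟩ := exists_cell hQ
  have hX : Nonempty X := nonempty_of_isProbabilityMeasure μ
  have hcard : 0 < Fintype.card {A // A ∈ P} := Fintype.card_pos_iff.2 ⟨p hX.some⟩
  have hGm : ∀ c, MeasurableSet ((fun x => q (π x)) ⁻¹' {c}) := fun c => hπ.measurable (hqm c)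
  set r : X → Bool := fun x => decide (x ∈ B) with hr
  have hrt : r ⁻¹' {true} = B := by ext x; simp [hr]
  have hrf : r ⁻¹' {false} = Bᶜ := by ext x; simp [hr]
  have hrm : ∀ c, MeasurableSet (r ⁻¹' {c}) := by
    intro c
    cases c
    · rw [hrf]; exact hBm.compl
    · rw [hrt]; exact hBm
  have hHr : Hf μ r + μ.real B * Real.log (Fintype.card {A // A ∈ P}) < ε := by
    have := hδ' (μ.real B) measureReal_nonneg hBδ
    unfold Hf
    rw [Fintype.sum_bool, hrt, hrf, probReal_compl_eq_one_sub hBm]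
    exact this
  -- choose a good time for `Q`
  obtain ⟨k, hk⟩ : ∃ k : ℕ, partInfo (μ.map π) (joinPart S Q (k + 1)) / ((k : ℝ) + 1)
      < entPart (μ.map π) S Q + ε :=
    exists_lt_of_ciInf_lt (lt_add_of_pos_right (entPart (μ.map π) S Q) hε)
  rw [partInfo_eq _ S q hq, ← Hf_map μ hπ.measurable hS.measurable hsemi q hqm,
    div_lt_iff₀ (by positivity)] at hk
  set n : ℕ := (M + 1) * (k + 1) with hn
  have hnpos : 0 < n := by positivity
  have hnR : (0 : ℝ) < n := by exact_mod_cast hnpos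
  have hMn : (M : ℝ) ≤ n := by
    have : M ≤ n := by rw [hn]; nlinarith
    exact_mod_cast this
  have hcount := main_count μ hinv p hpm (nm T (fun x => q (π x)) n)
    (nm_meas hT.measurable _ hGm n) r hrm n (Real.exp (ε * (n + M))) (Real.exp_pos _) hcard (by
      intro c
      obtain ⟨F, hFc, hFs, hFD⟩ := hM n (fun i => if h : i < n then (c ⟨i, h⟩ : Set Y) else ∅)
        (fun i hi => by rw [dif_pos hi]; exact (c ⟨i, hi⟩).2)
      refine ⟨F, hFc, ?_, ?_⟩
      · intro x hx
        refine hFs ?_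
        intro i hi
        rw [dif_pos hi]
        rw [← hq]
        exact congrFun (hx : nm T (fun x => q (π x)) n x = c) ⟨i, hi⟩
      · intro D hD x hx x' hx' i hi h1 h2
        refine hVB _ _ (hFD D hD x hx x' hx' i hi) ?_ ?_
        · simpa [hr] using h1
        · simpa [hr] using h2)
  rw [Real.log_exp, hrt] at hcount
  have hmul := Hf_nm_mul hinv (fun x => q (π x)) hGm (M + 1) (k + 1)
  rw [← hn] at hmul
  have hb := entPart_le μ T hP n hnpos
  rw [partInfo_eq μ T p hp, le_div_iff₀ hnR] at hb
  have hnR' : (n : ℝ) = ((M : ℝ) + 1) * ((k : ℝ) + 1) := by rw [hn]; push_cast; ring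
  have h3 : Hf μ (nm T (fun x => q (π x)) n) ≤ n * (entPart (μ.map π) S Q + ε) := by
    refine hmul.trans ?_
    rw [hnR']
    push_cast
    have := mul_le_mul_of_nonneg_left hk.le (by positivity : (0 : ℝ) ≤ (M : ℝ) + 1)
    calc _ ≤ _ := this
      _ = _ := by ring
  have h4 : (n : ℝ) * (Hf μ r + μ.real B * Real.log (Fintype.card {A // A ∈ P})) ≤ n * ε :=
    mul_le_mul_of_nonneg_left hHr.le hnR.le
  have h5 : ε * (n + M) ≤ ε * (n + n) := by
    refine mul_le_mul_of_nonneg_left ?_ hε.le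
    linarith
  have h6 : entPart μ T P * n ≤ (entPart (μ.map π) S Q + 4 * ε) * n := by
    linarith
  exact le_of_mul_le_mul_right h6 hnR

end mainineq
/-- Bowen's entropy-preservation theorem: if `π` is a continuous surjective
semiconjugacy between continuous maps of compact metric spaces all of whose
fibers have zero topological entropy, then `h(T, μ) = h(S, π_*μ)` for every
`T`-invariant Borel probability measure `μ`. -/
theorem stmt_13 {X Y : Type*}
    [MetricSpace X] [CompactSpace X] [MeasurableSpace X] [BorelSpace X]
    [MetricSpace Y] [CompactSpace Y] [MeasurableSpace Y] [BorelSpace Y]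
    (T : X → X) (S : Y → Y) (hT : Continuous T) (hS : Continuous S)
    (π : X → Y) (hπ : Continuous π) (hsurj : Function.Surjective π)
    (hsemi : π ∘ T = S ∘ π)
    (hfib : ∀ y : Y, coverEntropy T (π ⁻¹' {y}) = 0)
    (μ : Measure X) [IsProbabilityMeasure μ] (hinv : MeasurePreserving T μ μ) :
    ksEntropy T μ = ksEntropy S (μ.map π) := by

  classical
  have h1 : ∀ Q : {Q : Finset (Set Y) // IsFinPartition Q},
      ∃ P : {P : Finset (Set X) // IsFinPartition P},
        entPart μ T (P : Finset (Set X)) = entPart (μ.map π) S (Q : Finset (Set Y)) := by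
    intro Q
    obtain ⟨a, b⟩ := entPart_pull μ hπ.measurable hS.measurable hsurj hsemi Q.1 Q.2
    exact ⟨⟨_, a⟩, b⟩
  have h2 : ∀ P : {P : Finset (Set X) // IsFinPartition P}, ∀ ε : ℝ, 0 < ε →
      ∃ Q : {Q : Finset (Set Y) // IsFinPartition Q},
        entPart μ T (P : Finset (Set X)) ≤ entPart (μ.map π) S (Q : Finset (Set Y)) + ε := by
    intro P ε hε
    obtain ⟨Q, hQ, hle⟩ := main_ineq T S hT hS π hπ hsemi hfib μ hinv P.1 P.2 (ε / 4) (by positivity)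
    exact ⟨⟨Q, hQ⟩, by linarith⟩
  have neY : Nonempty {Q : Finset (Set Y) // IsFinPartition Q} :=
    ⟨⟨{Set.univ}, by simp [IsFinPartition]⟩⟩
  have neX : Nonempty {P : Finset (Set X) // IsFinPartition P} :=
    ⟨⟨{Set.univ}, by simp [IsFinPartition]⟩⟩
  unfold ksEntropy
  by_cases hbdd : BddAbove (Set.range fun Q : {Q : Finset (Set Y) // IsFinPartition Q} =>
      entPart (μ.map π) S (Q : Finset (Set Y)))
  · have hle : ∀ P : {P : Finset (Set X) // IsFinPartition P},
        entPart μ T (P : Finset (Set X)) ≤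
          ⨆ Q : {Q : Finset (Set Y) // IsFinPartition Q},
            entPart (μ.map π) S (Q : Finset (Set Y)) := by
      intro P
      refine le_of_forall_pos_le_add fun ε hε => ?_
      obtain ⟨Q, hQ⟩ := h2 P ε hε
      have := le_ciSup hbdd Q
      linarith
    refine le_antisymm (ciSup_le hle) (ciSup_le fun Q => ?_)
    obtain ⟨P, hPQ⟩ := h1 Q
    rw [← hPQ]
    refine le_ciSup (f := fun P : {P : Finset (Set X) // IsFinPartition P} =>
      entPart μ T (P : Finset (Set X))) ?_ P
    exact ⟨_, Set.forall_mem_range.2 hle⟩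
  · have hbdd' : ¬ BddAbove (Set.range fun P : {P : Finset (Set X) // IsFinPartition P} =>
        entPart μ T (P : Finset (Set X))) := by
      rintro ⟨C, hC⟩
      refine hbdd ⟨C, ?_⟩
      rintro _ ⟨Q, rfl⟩
      obtain ⟨P, hPQ⟩ := h1 Q
      simp only
      rw [← hPQ]
      exact hC ⟨P, rfl⟩
    rw [Real.iSup_of_not_bddAbove hbdd, Real.iSup_of_not_bddAbove hbdd']
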